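/- Let G be a graph, r a vertex of G, and let 𝒮 = {S_1,…,S_t} be a nice collection of trees in G rooted at r. Then G contains a collection of independent spanning trees T_1,…,T_t rooted at r such that S_i is a subgraph of T_i for each i ∈ {1,…,t}. -/

import Mathlib

/-- `T` is a family of independent spanning trees of `G` rooted at `r`:
each `T i` is a spanning tree of `G`, and for every vertex `v` the unique `r`–`v`
paths in the trees are pairwise internally vertex-disjoint. -/
def IsISTFamily {V : Type*} (G : SimpleGraph V) (r : V) {t : ℕ}
    (T : Fin t → SimpleGraph V) : Prop :=
  (∀ i, T i ≤ G ∧ (T i).IsTree) ∧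
  ∀ i j : Fin t, i ≠ j → ∀ (v : V) (P : (T i).Path r v) (Q : (T j).Path r v) (x : V),
    x ∈ (P : (T i).Walk r v).support → x ∈ (Q : (T j).Walk r v).support → x = r ∨ x = v

/-- `I(v)`: the set of indices `i` such that the subgraph `S i` contains neither `v` nor
any neighbour of `v`. -/
def Iset {V : Type*} {G : SimpleGraph V} {t : ℕ} (S : Fin t → G.Subgraph) (v : V) :
    Set (Fin t) :=
  {i | v ∉ (S i).verts ∧ ∀ y ∈ (S i).verts, ¬ G.Adj v y}

/-- A *nice* collection of trees: subtrees `S 1, …, S t` of `G`, all containing `r` and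
pairwise vertex-disjoint apart from `r`, such that for every vertex `v` one can choose,
for each `i ∈ I(v)`, vertices `u i ∉ ⋃ j, V(S j)` and `w i ∈ V(S i)` with the `u i`
pairwise distinct and `v–(u i)–(w i)` a two-edge path in `G`. -/
def NiceCollection {V : Type*} (G : SimpleGraph V) (r : V) {t : ℕ}
    (S : Fin t → G.Subgraph) : Prop :=
  (∀ i, r ∈ (S i).verts) ∧
  (∀ i, (S i).coe.IsTree) ∧
  (∀ i j, i ≠ j → (S i).verts ∩ (S j).verts ⊆ {r}) ∧
  ∀ v : V, ∃ u w : Fin t → V,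
    (∀ i ∈ Iset S v,
      u i ∉ ⋃ j, (S j).verts ∧ w i ∈ (S i).verts ∧ G.Adj v (u i) ∧ G.Adj (u i) (w i)) ∧
    (∀ i ∈ Iset S v, ∀ j ∈ Iset S v, i ≠ j → u i ≠ u j)

/-- Attach to the subgraph `H` every vertex `a` outside `H` by an edge to `p a`. -/
def attachParents {V : Type*} {G : SimpleGraph V} (H : G.Subgraph) (p : V → V) :
    SimpleGraph V :=
  H.spanningCoe ⊔ SimpleGraph.fromEdgeSet ((fun a => s(a, p a)) '' H.vertsᶜ)

namespace attachParents

variable {V : Type*} {G : SimpleGraph V} {H : G.Subgraph} {p : V → V}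

lemma adj_parent (hp : ∀ a ∉ H.verts, G.Adj a (p a)) {a : V} (ha : a ∉ H.verts) :
    (attachParents H p).Adj (p a) a := by
  refine Or.inr ((SimpleGraph.fromEdgeSet_adj _).2 ⟨⟨a, ha, ?_⟩, (hp a ha).ne'⟩)
  exact Sym2.eq_swap

lemma le_of_adj (hp : ∀ a ∉ H.verts, G.Adj a (p a)) : attachParents H p ≤ G := by
  refine sup_le H.spanningCoe_le fun x y h => ?_
  obtain ⟨⟨a, ha, he⟩, -⟩ := (SimpleGraph.fromEdgeSet_adj _).1 h
  rw [← SimpleGraph.mem_edgeSet, ← he]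
  exact hp a ha

lemma exists_walk_mem_verts (hH : H.coe.Connected) {r v : V} (hr : r ∈ H.verts)
    (hv : v ∈ H.verts) :
    ∃ W : (attachParents H p).Walk r v, ∀ x ∈ W.support, x ∈ H.verts := by
  obtain ⟨W⟩ := hH.preconnected ⟨r, hr⟩ ⟨v, hv⟩
  let f : H.coe →g attachParents H p := ⟨Subtype.val, fun h => Or.inl h⟩
  refine ⟨W.map f, fun x hx => ?_⟩
  rw [SimpleGraph.Walk.support_map, List.mem_map] at hx
  obtain ⟨y, -, rfl⟩ := hx
  exact y.2

/-- If every vertex reaches `H` after at most two parent steps, it is joined to a vertex of `H`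
by a walk which leaves `H` only at the vertex itself and, possibly, its parent. -/
lemma exists_walk (hH : H.coe.Connected) (hp : ∀ a ∉ H.verts, G.Adj a (p a))
    (hpp : ∀ a ∉ H.verts, p a ∉ H.verts → p (p a) ∈ H.verts) {r : V} (hr : r ∈ H.verts) (v : V) :
    ∃ W : (attachParents H p).Walk r v,
      ∀ x ∈ W.support, x ∈ H.verts ∨ x = v ∨ (v ∉ H.verts ∧ x = p v) := by
  by_cases hv : v ∈ H.verts
  · obtain ⟨W, hW⟩ := exists_walk_mem_verts (p := p) hH hr hv
    exact ⟨W, fun x hx => Or.inl (hW x hx)⟩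
  by_cases hpv : p v ∈ H.verts
  · obtain ⟨W, hW⟩ := exists_walk_mem_verts (p := p) hH hr hpv
    refine ⟨W.concat (adj_parent hp hv), fun x hx => ?_⟩
    simp only [SimpleGraph.Walk.support_concat, List.mem_append,
      List.mem_singleton] at hx
    rcases hx with hx | hx
    · exact Or.inl (hW x hx)
    · exact Or.inr (Or.inl hx)
  · obtain ⟨W, hW⟩ := exists_walk_mem_verts (p := p) hH hr (hpp v hv hpv)
    refine ⟨(W.concat (adj_parent hp hpv)).concat (adj_parent hp hv), fun x hx => ?_⟩
    simp only [SimpleGraph.Walk.support_concat, List.mem_append,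
      List.mem_singleton] at hx
    rcases hx with (hx | hx) | hx
    · exact Or.inl (hW x hx)
    · exact Or.inr (Or.inr ⟨hv, hx⟩)
    · exact Or.inr (Or.inl hx)

lemma card_edgeSet_add_one_le [Finite V] (hH : H.coe.IsTree) :
    Nat.card (attachParents H p).edgeSet + 1 ≤ Nat.card V := by
  have hle : (attachParents H p).edgeSet ⊆
      Sym2.map Subtype.val '' H.coe.edgeSet ∪ (fun a => s(a, p a)) '' H.vertsᶜ := by
    intro e he
    induction e with | _ x y
    rcases he with he | he
    · exact Or.inl ⟨s(⟨x, H.edge_vert he⟩, ⟨y, H.edge_vert he.symm⟩), he, rfl⟩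
    · exact Or.inr ((SimpleGraph.fromEdgeSet_adj _).1 he).1
  have h1 := (Set.ncard_le_ncard hle).trans (Set.ncard_union_le _ _)
  have h2 : (Sym2.map Subtype.val '' H.coe.edgeSet).ncard ≤ H.coe.edgeSet.ncard :=
    Set.ncard_image_le
  have h3 : ((fun a => s(a, p a)) '' H.vertsᶜ).ncard ≤ H.vertsᶜ.ncard := Set.ncard_image_le
  have h4 := (SimpleGraph.isTree_iff_connected_and_card.1 hH).2
  have h5 := Set.ncard_add_ncard_compl H.verts
  rw [Nat.card_coe_set_eq] at h4 ⊢
  rw [Nat.card_coe_set_eq] at h4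
  omega

lemma isTree [Finite V] (hH : H.coe.IsTree) (hp : ∀ a ∉ H.verts, G.Adj a (p a))
    (hpp : ∀ a ∉ H.verts, p a ∉ H.verts → p (p a) ∈ H.verts) :
    (attachParents H p).IsTree := by
  obtain ⟨r, hr⟩ := hH.connected.nonempty
  have hc : (attachParents H p).Connected :=
    (SimpleGraph.connected_iff_exists_forall_reachable _).2
      ⟨r, fun v => ⟨(exists_walk hH.connected hp hpp hr v).choose⟩⟩
  exact SimpleGraph.isTree_iff_connected_and_card.2
    ⟨hc, (card_edgeSet_add_one_le hH).antisymm hc.card_vert_le_card_edgeSet_add_one⟩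

lemma mem_of_mem_support_path [Finite V] (hH : H.coe.IsTree)
    (hp : ∀ a ∉ H.verts, G.Adj a (p a))
    (hpp : ∀ a ∉ H.verts, p a ∉ H.verts → p (p a) ∈ H.verts) {r : V} (hr : r ∈ H.verts) {v : V}
    (P : (attachParents H p).Path r v) {x : V}
    (hx : x ∈ (P : (attachParents H p).Walk r v).support) :
    x ∈ H.verts ∨ x = v ∨ (v ∉ H.verts ∧ x = p v) := by
  classical
  obtain ⟨W, hW⟩ := exists_walk hH.connected hp hpp hr v
  have := (isTree hH hp hpp).isAcyclic.subsingleton_path r v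
  rw [Subsingleton.elim P W.toPath] at hx
  exact hW x (W.support_bypass_subset_support hx)

end attachParents

/-- A nice collection admits parent functions: every vertex outside `S i` is sent to a neighbour
in `S i`, if there is one, and otherwise to a vertex outside all trees having a neighbour in
`S i`, where parents of the latter kind at a common vertex are distinct. -/
lemma NiceCollection.exists_parent {V : Type*} {G : SimpleGraph V} {r : V} {t : ℕ}
    {S : Fin t → G.Subgraph} (hS : NiceCollection G r S) :
    ∃ p : Fin t → V → V,
      (∀ i, ∀ a ∉ (S i).verts, G.Adj a (p i a)) ∧
      (∀ i, ∀ a ∉ (S i).verts, p i a ∉ (S i).verts → p i (p i a) ∈ (S i).verts) ∧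
      (∀ i, ∀ a ∉ (S i).verts, p i a ∉ (S i).verts → ∀ j, p i a ∉ (S j).verts) ∧
      (∀ i j, i ≠ j → ∀ a, a ∉ (S i).verts → a ∉ (S j).verts →
        p i a ∉ (S i).verts → p j a ∉ (S j).verts → p i a ≠ p j a) := by
  classical
  obtain ⟨-, -, -, h⟩ := hS
  choose u w h hu using h
  let p : Fin t → V → V := fun i a =>
    if ha : ∃ y ∈ (S i).verts, G.Adj a y then ha.choose else u a i
  have hpos : ∀ i a, (∃ y ∈ (S i).verts, G.Adj a y) → p i a ∈ (S i).verts ∧ G.Adj a (p i a) := by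
    intro i a ha
    simp only [p, dif_pos ha]
    exact ha.choose_spec
  have hcases : ∀ i, ∀ a ∉ (S i).verts,
      (p i a ∈ (S i).verts ∧ G.Adj a (p i a)) ∨ (i ∈ Iset S a ∧ p i a = u a i) := by
    intro i a ha
    by_cases hy : ∃ y ∈ (S i).verts, G.Adj a y
    · exact Or.inl (hpos i a hy)
    · exact Or.inr ⟨⟨ha, fun y hy1 hy2 => hy ⟨y, hy1, hy2⟩⟩, dif_neg hy⟩
  have hout : ∀ i, ∀ a ∉ (S i).verts, p i a ∉ (S i).verts → i ∈ Iset S a ∧ p i a = u a i :=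
    fun i a ha hpa => (hcases i a ha).resolve_left fun hc => hpa hc.1
  refine ⟨p, fun i a ha => ?_, fun i a ha hpa => ?_, fun i a ha hpa j hj => ?_,
    fun i j hij a hai haj hpi hpj => ?_⟩
  · rcases hcases i a ha with hc | ⟨hI, he⟩
    · exact hc.2
    · exact he ▸ (h a i hI).2.2.1
  · obtain ⟨hI, he⟩ := hout i a ha hpa
    obtain ⟨-, hw, -, hadj⟩ := h a i hI
    exact (hpos i _ ⟨w a i, hw, he ▸ hadj⟩).1
  · obtain ⟨hI, he⟩ := hout i a ha hpa
    exact (h a i hI).1 (Set.mem_iUnion.2 ⟨j, he ▸ hj⟩)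
  · obtain ⟨hI, hi⟩ := hout i a hai hpi
    obtain ⟨hJ, hj⟩ := hout j a haj hpj
    rw [hi, hj]
    exact hu a i hI j hJ hij

/-- **Nice collections of trees extend to independent spanning trees.**
If `G` contains a nice collection of trees `S 1, …, S t` rooted at `r`, then `G` contains
independent spanning trees `T 1, …, T t` rooted at `r` with `S i ⊆ T i` for each `i`. -/
theorem niceCollection_to_ISTs {V : Type*} [Fintype V] (G : SimpleGraph V) (r : V)
    {t : ℕ} (S : Fin t → G.Subgraph) (hS : NiceCollection G r S) :
    ∃ T : Fin t → SimpleGraph V, IsISTFamily G r T ∧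
      ∀ i, (S i).spanningCoe ≤ T i := by
  obtain ⟨p, hp, hpp, hout, hdis⟩ := hS.exists_parent
  obtain ⟨hr, hT, hint, -⟩ := hS
  refine ⟨fun i => attachParents (S i) (p i), ⟨fun i => ⟨attachParents.le_of_adj (hp i),
    attachParents.isTree (hT i) (hp i) (hpp i)⟩, fun i j hij v P Q x hxP hxQ => ?_⟩,
    fun i => le_sup_left⟩
  have hi := attachParents.mem_of_mem_support_path (hT i) (hp i) (hpp i) (hr i) P hxP
  have hj := attachParents.mem_of_mem_support_path (hT j) (hp j) (hpp j) (hr j) Q hxQ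
  have hmeet : x ∈ (S i).verts → x ∈ (S j).verts → x = r := fun h1 h2 => hint i j hij ⟨h1, h2⟩
  rw [or_iff_not_imp_right]
  intro hxv
  by_cases h1 : x ∈ (S i).verts
  · by_cases h2 : x ∈ (S j).verts
    · exact hmeet h1 h2
    · obtain ⟨hvj, rfl⟩ := (hj.resolve_left h2).resolve_left hxv
      exact absurd h1 (hout j v hvj h2 i)
  · obtain ⟨hvi, rfl⟩ := (hi.resolve_left h1).resolve_left hxv
    have h2 := hout i v hvi h1 j
    obtain ⟨hvj, he⟩ := (hj.resolve_left h2).resolve_left hxv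
    exact absurd he (hdis i j hij v hvi hvj h1 (he ▸ h2))
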